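/- arXiv:2112.03638 — 3 statements merged into one kernel-verified Lean document; each statement's English description precedes it below -/
import Mathlib

section
/- Unbiasedness of Randomized Forward (Theorem 1): for every step t ∈ {1,…,T} and every state i, the randomized forward variable satisfies E[α̂_t(i)] = α_t(i), where the expectation is over all samples δ_{s,j} with s < t; moreover, the final randomized estimate satisfies E[Ẑ] = Z. -/
open Finset

/-- Exact forward recursion, 0-based: `forwardAlpha α1 Φ (t-1)` is the paper's `α_t`,
so `forwardAlpha α1 Φ 0 = α_1` and `α_{t+1}(i) = Σ_j α_t(j) Φ_t(j,i)`. -/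
def forwardAlpha {N : ℕ} (α1 : Fin N → ℝ) (Φ : ℕ → Fin N → Fin N → ℝ) :
    ℕ → Fin N → ℝ
  | 0 => α1
  | t + 1 => fun i => ∑ j, forwardAlpha α1 Φ t j * Φ t j i

/-- Randomized forward recursion (Alg. 1), 0-based, for a fixed realization
`δ` of the samples: `α̂_1 = α_1` and
`α̂_{t+1}(i) = Σ_{σ ∈ Ω_t} α̂_t(σ) Φ_t(σ,i) + (1/K2) Σ_j α̂_t(δ_{t,j}) Φ_t(δ_{t,j},i) / q_t(δ_{t,j})`. -/
noncomputable def rforwardAlpha {N : ℕ} (K2 : ℕ) (α1 : Fin N → ℝ)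
    (Φ : ℕ → Fin N → Fin N → ℝ) (Ω : ℕ → Finset (Fin N)) (q : ℕ → Fin N → ℝ)
    (δ : ℕ → Fin K2 → Fin N) : ℕ → Fin N → ℝ
  | 0 => α1
  | t + 1 => fun i =>
      (∑ σ ∈ Ω t, rforwardAlpha K2 α1 Φ Ω q δ t σ * Φ t σ i) +
        (1 / (K2 : ℝ)) *
          ∑ j, rforwardAlpha K2 α1 Φ Ω q δ t (δ t j) * Φ t (δ t j) i / q t (δ t j)

/-- Under a product weight, resampling one coordinate does not change the weighted sum. -/
theorem sum_prod_mul_eq_sum_update {ι β : Type*} [Fintype ι] [DecidableEq ι] [Fintype β]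
    (p : ι → β → ℝ) (t : ι) (hp : ∑ b, p t b = 1) (G : (ι → β) → ℝ) :
    ∑ δ, (∏ s, p s (δ s)) * G δ =
      ∑ δ, (∏ s, p s (δ s)) * ∑ b, p t b * G (Function.update δ t b) := by
  classical
  have hswap : Function.Involutive
      (fun x : (ι → β) × β => (Function.update x.1 t x.2, x.1 t)) := by
    rintro ⟨δ, b⟩
    simp
  have hweight : ∀ (δ : ι → β) (b : β),
      (∏ s, p s (Function.update δ t b s)) * p t (δ t) = (∏ s, p s (δ s)) * p t b := by
    intro δ b
    rw [← Finset.mul_prod_erase _ _ (Finset.mem_univ t),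
      ← Finset.mul_prod_erase _ (fun s => p s (δ s)) (Finset.mem_univ t)]
    have : ∏ s ∈ univ.erase t, p s (Function.update δ t b s) =
        ∏ s ∈ univ.erase t, p s (δ s) :=
      Finset.prod_congr rfl fun s hs => by
        rw [Function.update_of_ne (Finset.ne_of_mem_erase hs)]
    rw [this, Function.update_self]
    ring
  calc ∑ δ, (∏ s, p s (δ s)) * G δ
      = ∑ x : (ι → β) × β, (∏ s, p s (x.1 s)) * p t x.2 * G x.1 := by
        rw [Fintype.sum_prod_type]
        refine Finset.sum_congr rfl fun δ _ => ?_
        simp only [← Finset.sum_mul, ← Finset.mul_sum, hp, mul_one]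
    _ = ∑ x : (ι → β) × β,
          (∏ s, p s (x.1 s)) * p t x.2 * G (Function.update x.1 t x.2) := by
        rw [← Equiv.sum_comp hswap.toPerm]
        refine Finset.sum_congr rfl fun x _ => ?_
        simp only [Function.Involutive.coe_toPerm]
        rw [hweight]
    _ = ∑ δ, (∏ s, p s (δ s)) * ∑ b, p t b * G (Function.update δ t b) := by
        rw [Fintype.sum_prod_type]
        simp only [Finset.mul_sum, mul_assoc]

theorem sum_pi_prod_eq_one {ι β : Type*} [Fintype ι] [DecidableEq ι] [Fintype β]
    (q : β → ℝ) (hq : ∑ x, q x = 1) : ∑ b : ι → β, ∏ j, q (b j) = 1 := by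
  rw [← Fintype.prod_sum fun (_ : ι) x => q x]
  simp [hq]

/-- The batch estimator that sums exactly over `Ω` and importance-samples its complement
is unbiased. -/
theorem sum_batch_estimator {β : Type*} [Fintype β] [DecidableEq β] {K : ℕ} (hK : 1 ≤ K)
    (Ω : Finset β) (q : β → ℝ) (hzero : ∀ i ∈ Ω, q i = 0) (hpos : ∀ i ∉ Ω, 0 < q i)
    (hsum : ∑ i, q i = 1) (f : β → ℝ) :
    ∑ b : Fin K → β, (∏ j, q (b j)) *
      ((∑ σ ∈ Ω, f σ) + (1 / (K : ℝ)) * ∑ j, f (b j) / q (b j)) = ∑ i, f i := by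
  have hone := sum_pi_prod_eq_one (ι := Fin K) q hsum
  have hcompl : ∑ x, q x * (f x / q x) = ∑ x ∈ Ωᶜ, f x := by
    rw [← Finset.sum_add_sum_compl Ω, Finset.sum_eq_zero fun x hx => by simp [hzero x hx],
      zero_add]
    exact Finset.sum_congr rfl fun x hx =>
      mul_div_cancel₀ _ (hpos x (Finset.mem_compl.mp hx)).ne'
  have hsample : ∀ j : Fin K,
      ∑ b : Fin K → β, (∏ k, q (b k)) * (f (b j) / q (b j)) = ∑ x ∈ Ωᶜ, f x := by
    intro j
    rw [sum_prod_mul_eq_sum_update (fun _ => q) j hsum (fun b => f (b j) / q (b j))]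
    simp only [Function.update_self]
    rw [← Finset.sum_mul, hone, one_mul, hcompl]
  have hK0 : (K : ℝ) ≠ 0 := by positivity
  have hmean : ∑ b : Fin K → β, (∏ k, q (b k)) * ((1 / (K : ℝ)) * ∑ j, f (b j) / q (b j)) =
      ∑ x ∈ Ωᶜ, f x := by
    simp only [mul_left_comm _ (1 / (K : ℝ)), ← Finset.mul_sum]
    have hswap : ∑ b : Fin K → β, (∏ k, q (b k)) * ∑ j, f (b j) / q (b j) =
        ∑ j, ∑ b : Fin K → β, (∏ k, q (b k)) * (f (b j) / q (b j)) := by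
      simp only [Finset.mul_sum]
      exact Finset.sum_comm
    rw [hswap]
    simp only [hsample, Finset.sum_const, Finset.card_univ, Fintype.card_fin, nsmul_eq_mul]
    field_simp
  simp only [mul_add, Finset.sum_add_distrib]
  rw [hmean, ← Finset.sum_mul, hone, one_mul, Finset.sum_add_sum_compl]

/-- Replacing the sum over states by the batch estimator at step `t` preserves expectations,
provided the summand does not depend on the samples drawn at step `t`. -/
theorem sum_prod_mul_batch_estimator {ι β : Type*} [Fintype ι] [DecidableEq ι] [Fintype β]
    [DecidableEq β] {K : ℕ} (hK : 1 ≤ K) (Ω : ι → Finset β) (q : ι → β → ℝ)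
    (hzero : ∀ t, ∀ i ∈ Ω t, q t i = 0) (hpos : ∀ t, ∀ i ∉ Ω t, 0 < q t i)
    (hsum : ∀ t, ∑ i, q t i = 1) (t : ι) (F : (ι → Fin K → β) → β → ℝ)
    (hF : ∀ δ b x, F (Function.update δ t b) x = F δ x) :
    ∑ δ : ι → Fin K → β, (∏ s, ∏ j, q s (δ s j)) *
        ((∑ σ ∈ Ω t, F δ σ) + (1 / (K : ℝ)) * ∑ j, F δ (δ t j) / q t (δ t j)) =
      ∑ i, ∑ δ : ι → Fin K → β, (∏ s, ∏ j, q s (δ s j)) * F δ i := by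
  refine (sum_prod_mul_eq_sum_update (fun s b => ∏ j, q s (b j)) t
    (sum_pi_prod_eq_one (q t) (hsum t)) fun δ =>
      (∑ σ ∈ Ω t, F δ σ) + (1 / (K : ℝ)) * ∑ j, F δ (δ t j) / q t (δ t j)).trans ?_
  refine Eq.trans ?_ Finset.sum_comm
  refine Finset.sum_congr rfl fun δ _ => ?_
  simp only [hF, Function.update_self]
  rw [sum_batch_estimator hK (Ω t) (q t) (hzero t) (hpos t) (hsum t) (F δ), Finset.mul_sum]

/-- The randomized forward variable at step `t` depends only on the earlier samples. -/
theorem rforwardAlpha_congr {N K2 : ℕ} (α1 : Fin N → ℝ) (Φ : ℕ → Fin N → Fin N → ℝ)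
    (Ω : ℕ → Finset (Fin N)) (q : ℕ → Fin N → ℝ) {δ δ' : ℕ → Fin K2 → Fin N} (t : ℕ)
    (h : ∀ s < t, δ s = δ' s) :
    rforwardAlpha K2 α1 Φ Ω q δ t = rforwardAlpha K2 α1 Φ Ω q δ' t := by
  induction t with
  | zero => rfl
  | succ t ih =>
    funext i
    simp only [rforwardAlpha, ih fun s hs => h s (hs.trans t.lt_succ_self),
      h t t.lt_succ_self]

/-- Theorem 1, unbiasedness of Randomized Forward: for every step
`t ∈ {1,…,T}` (0-based: `t < T`) and every state `i`, `E[α̂_t(i)] = α_t(i)`, where the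
expectation is the explicit weighted sum over all sample realizations
`δ : Fin T → Fin K2 → Fin N` with i.i.d. weights `∏_{s,j} q_s(δ_{s,j})`;
moreover the final randomized estimate satisfies `E[Ẑ] = Z`. -/
theorem randomized_forward_unbiased
    (N T K2 : ℕ) (hN : 0 < N) (hT : 1 ≤ T) (hK2 : 1 ≤ K2)
    (α1 : Fin N → ℝ) (hα1 : ∀ i, 0 ≤ α1 i)
    (Φ : ℕ → Fin N → Fin N → ℝ) (hΦ : ∀ t i j, 0 ≤ Φ t i j)
    (Ω : ℕ → Finset (Fin N)) (q : ℕ → Fin N → ℝ)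
    (hq_zero : ∀ t, ∀ i ∈ Ω t, q t i = 0)
    (hq_pos : ∀ t, ∀ i ∉ Ω t, 0 < q t i)
    (hq_sum : ∀ t, ∑ i, q t i = 1) :
    (∀ t < T, ∀ i : Fin N,
        ∑ δ : Fin T → Fin K2 → Fin N,
            (∏ s : Fin T, ∏ j : Fin K2, q s.1 (δ s j)) *
              rforwardAlpha K2 α1 Φ Ω q
                (fun s => if h : s < T then δ ⟨s, h⟩ else fun _ => ⟨0, hN⟩) t i =
          forwardAlpha α1 Φ t i) ∧
      ∑ δ : Fin T → Fin K2 → Fin N,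
          (∏ s : Fin T, ∏ j : Fin K2, q s.1 (δ s j)) *
            ((∑ σ ∈ Ω (T - 1),
                rforwardAlpha K2 α1 Φ Ω q
                  (fun s => if h : s < T then δ ⟨s, h⟩ else fun _ => ⟨0, hN⟩)
                  (T - 1) σ) +
              (1 / (K2 : ℝ)) *
                ∑ j, rforwardAlpha K2 α1 Φ Ω q
                    (fun s => if h : s < T then δ ⟨s, h⟩ else fun _ => ⟨0, hN⟩)
                    (T - 1) (δ ⟨T - 1, by omega⟩ j) /
                  q (T - 1) (δ ⟨T - 1, by omega⟩ j)) =
        ∑ i, forwardAlpha α1 Φ (T - 1) i := by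
  have hindep : ∀ (t : ℕ) (ht : t < T) (δ : Fin T → Fin K2 → Fin N) (b : Fin K2 → Fin N),
      rforwardAlpha K2 α1 Φ Ω q
        (fun s => if h : s < T then Function.update δ ⟨t, ht⟩ b ⟨s, h⟩ else fun _ => ⟨0, hN⟩) t =
      rforwardAlpha K2 α1 Φ Ω q
        (fun s => if h : s < T then δ ⟨s, h⟩ else fun _ => ⟨0, hN⟩) t := by
    intro t ht δ b
    refine rforwardAlpha_congr α1 Φ Ω q t fun s hs => ?_
    have hne : (⟨s, hs.trans ht⟩ : Fin T) ≠ ⟨t, ht⟩ := by simp [hs.ne]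
    simp only [dif_pos (hs.trans ht), Function.update_of_ne hne]
  have hstep := fun t : Fin T => sum_prod_mul_batch_estimator hK2 (fun s : Fin T => Ω s)
    (fun s : Fin T => q s) (fun s => hq_zero s) (fun s => hq_pos s) (fun s => hq_sum s) t
  have hforward : ∀ t < T, ∀ i : Fin N,
      ∑ δ : Fin T → Fin K2 → Fin N,
          (∏ s : Fin T, ∏ j : Fin K2, q s.1 (δ s j)) *
            rforwardAlpha K2 α1 Φ Ω q
              (fun s => if h : s < T then δ ⟨s, h⟩ else fun _ => ⟨0, hN⟩) t i =
        forwardAlpha α1 Φ t i := by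
    intro t
    induction t with
    | zero =>
      intro _ i
      simp only [rforwardAlpha, forwardAlpha]
      rw [← Finset.sum_mul,
        ← Fintype.prod_sum fun (s : Fin T) (b : Fin K2 → Fin N) => ∏ j, q s (b j)]
      simp [sum_pi_prod_eq_one _ (hq_sum _)]
    | succ t ih =>
      intro ht i
      have ht' : t < T := t.lt_succ_self.trans ht
      simp only [rforwardAlpha, forwardAlpha, dif_pos ht']
      refine (hstep ⟨t, ht'⟩ (fun δ x => rforwardAlpha K2 α1 Φ Ω q
        (fun s => if h : s < T then δ ⟨s, h⟩ else fun _ => ⟨0, hN⟩) t x * Φ t x i)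
        fun δ b x => by simp only [hindep t ht']).trans ?_
      refine Finset.sum_congr rfl fun x _ => ?_
      simp only [← mul_assoc]
      rw [← Finset.sum_mul, ih ht']
  refine ⟨hforward, ?_⟩
  have hlast : T - 1 < T := by omega
  refine (hstep ⟨T - 1, hlast⟩ (fun δ x => rforwardAlpha K2 α1 Φ Ω q
    (fun s => if h : s < T then δ ⟨s, h⟩ else fun _ => ⟨0, hN⟩) (T - 1) x)
    fun δ b x => by simp only [hindep (T - 1) hlast]).trans ?_
  exact Finset.sum_congr rfl fun x _ => hforward (T - 1) hlast x
end

section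
/- Second-moment recursion of single-sample Randomized Forward: for every step t ∈ {1,…,T−1} and every state i, E[α̂_{t+1}(i)²] = Σ_{j=1}^N (Φ_t(j,i)²/q_t(j)) · E[α̂_t(j)²]. -/
open Finset

/-- Single-sample randomized forward recursion (the case `K1 = 0`, `K2 = 1` of
Randomized Forward), 0-based, for a fixed realization `δ` of the samples:
`α̂_1 = α_1` and `α̂_{t+1}(i) = α̂_t(δ_t)·Φ_t(δ_t,i)/q_t(δ_t)`. -/
noncomputable def ssForwardAlpha {N : ℕ} (α1 : Fin N → ℝ)
    (Φ : ℕ → Fin N → Fin N → ℝ) (q : ℕ → Fin N → ℝ) (δ : ℕ → Fin N) :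
    ℕ → Fin N → ℝ
  | 0 => α1
  | t + 1 => fun i => ssForwardAlpha α1 Φ q δ t (δ t) * Φ t (δ t) i / q t (δ t)

/-- Against product weights, the coordinate `e` can be averaged out separately from a function
`F` that depends on `e` only through its first argument. -/
theorem sum_prod_mul_eval_eq_sum_mul {ι κ R : Type*} [Fintype ι] [DecidableEq ι] [Fintype κ]
    [CommSemiring R] (w : ι → κ → R) (e : ι) (hw : ∑ j, w e j = 1) (F : κ → (ι → κ) → R)
    (hF : ∀ j k δ, F j (Function.update δ e k) = F j δ) :
    ∑ δ : ι → κ, (∏ s, w s (δ s)) * F (δ e) δ =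
      ∑ j, w e j * ∑ δ : ι → κ, (∏ s, w s (δ s)) * F j δ := by
  have hprod (δ : ι → κ) (j : κ) :
      (∏ s, w s (Function.update δ e j s)) * w e (δ e) = (∏ s, w s (δ s)) * w e j := by
    rw [← mul_prod_erase univ (fun s => w s (Function.update δ e j s)) (mem_univ e),
      ← mul_prod_erase univ (fun s => w s (δ s)) (mem_univ e),
      prod_congr rfl fun s hs => by rw [Function.update_of_ne (ne_of_mem_erase hs)],
      Function.update_self]
    ring
  have hswap : Function.Involutive
      fun p : (ι → κ) × κ => (Function.update p.1 e p.2, p.1 e) := by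
    rintro ⟨δ, j⟩
    simp
  calc
    _ = ∑ p : (ι → κ) × κ, (∏ s, w s (p.1 s)) * w e p.2 * F (p.1 e) p.1 := by
      rw [Fintype.sum_prod_type]
      refine sum_congr rfl fun δ _ => ?_
      simp only [← sum_mul, ← mul_sum, hw, mul_one]
    _ = ∑ p : (ι → κ) × κ, (∏ s, w s (p.1 s)) * w e p.2 * F p.2 p.1 := by
      refine Fintype.sum_equiv hswap.toPerm _ _ fun p => ?_
      simp only [Function.Involutive.coe_toPerm, hprod, hF]
    _ = _ := by
      rw [Fintype.sum_prod_type, sum_comm]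
      refine sum_congr rfl fun j _ => ?_
      rw [mul_sum]
      exact sum_congr rfl fun δ _ => by ring

/-- The estimate at time `t` depends only on the samples drawn before `t`. -/
theorem ssForwardAlpha_congr {N : ℕ} (α1 : Fin N → ℝ) (Φ : ℕ → Fin N → Fin N → ℝ)
    (q : ℕ → Fin N → ℝ) {δ δ' : ℕ → Fin N} {t : ℕ} (h : ∀ s < t, δ s = δ' s) :
    ssForwardAlpha α1 Φ q δ t = ssForwardAlpha α1 Φ q δ' t := by
  induction t with
  | zero => rfl
  | succ t ih =>
    ext i
    simp only [ssForwardAlpha, ih fun s hs => h s (hs.trans t.lt_succ_self), h t t.lt_succ_self]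

/-- second-moment recursion of single-sample Randomized Forward.
For every step `t ∈ {1,…,T−1}` (0-based: `t + 1 < T`) and every state `i`,
`E[α̂_{t+1}(i)²] = Σ_{j=1}^N (Φ_t(j,i)²/q_t(j))·E[α̂_t(j)²]`, where the
expectation is the explicit weighted sum over all sample realizations
`δ : Fin T → Fin N` with i.i.d. weights `∏_s q_s(δ_s)`. -/
theorem ss_forward_second_moment_recursion
    (N T : ℕ) (hN : 0 < N)
    (α1 : Fin N → ℝ) (hα1 : ∀ i, 0 < α1 i)
    (Φ : ℕ → Fin N → Fin N → ℝ) (hΦ : ∀ t i j, 0 < Φ t i j)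
    (q : ℕ → Fin N → ℝ) (hq_pos : ∀ t j, 0 < q t j)
    (hq_sum : ∀ t, ∑ j, q t j = 1) :
    ∀ t, t + 1 < T → ∀ i : Fin N,
      ∑ δ : Fin T → Fin N,
          (∏ s : Fin T, q s.1 (δ s)) *
            (ssForwardAlpha α1 Φ q
              (fun s => if h : s < T then δ ⟨s, h⟩ else ⟨0, hN⟩) (t + 1) i) ^ 2 =
        ∑ j, (Φ t j i) ^ 2 / q t j *
          (∑ δ : Fin T → Fin N,
            (∏ s : Fin T, q s.1 (δ s)) *
              (ssForwardAlpha α1 Φ q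
                (fun s => if h : s < T then δ ⟨s, h⟩ else ⟨0, hN⟩) t j) ^ 2) := by
  intro t ht i
  have htT : t < T := t.lt_succ_self.trans ht
  have key := sum_prod_mul_eval_eq_sum_mul (fun s : Fin T => q s) ⟨t, htT⟩ (hq_sum t)
    (fun j δ => (ssForwardAlpha α1 Φ q
      (fun s => if h : s < T then δ ⟨s, h⟩ else ⟨0, hN⟩) t j * Φ t j i / q t j) ^ 2) (by
      intro j k δ
      rw [ssForwardAlpha_congr α1 Φ q fun s hs => ?_]
      have hsT : s < T := hs.trans htT
      simp [hsT, Function.update_of_ne, hs.ne])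
  simp only [ssForwardAlpha, dif_pos htT]
  refine key.trans (sum_congr rfl fun j _ => ?_)
  rw [mul_sum, mul_sum]
  refine sum_congr rfl fun δ _ => ?_
  have := (hq_pos t j).ne'
  field_simp
end

section
/- Multiplicative growth of relative second moments in single-sample Randomized Forward: with J_t = max_{1≤j≤N} E[α̂_t(j)²]/α_t(j)² and C_t = max_{1≤i≤N} (1 + Σ_{j=1}^N ε_t(j,i)²/q_t(j)) where ε_t(j,i) = α_t(j)Φ_t(j,i)/α_{t+1}(i) − q_t(j), one has J_1 = 1 and J_{t+1} ≤ C_t · J_t for every t; consequently J_T ≤ Π_{t=1}^{T−1} C_t, so the relative second moment of the forward estimates is controlled by the product over steps of the proposal-gap factors. -/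
open Finset

/-- Averaging out the coordinate `a` of a product weight: if `F k` ignores the coordinate `a`,
then evaluating at `k = δ a` amounts to sampling `k` from `p a` independently of `δ`. -/
theorem sum_prod_mul_eval_eq_sum_mul_sum {ι β R : Type*} [Fintype ι] [DecidableEq ι]
    [Fintype β] [CommSemiring R] (p : ι → β → R) (a : ι) (hp : ∑ k, p a k = 1)
    (F : β → (ι → β) → R) (hF : ∀ k δ x, F k (Function.update δ a x) = F k δ) :
    ∑ δ : ι → β, (∏ u, p u (δ u)) * F (δ a) δ =
      ∑ k, p a k * ∑ δ : ι → β, (∏ u, p u (δ u)) * F k δ := by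
  have weight_swap (k : β) (δ : ι → β) :
      p a (δ a) * ∏ u, p u (Function.update δ a k u) = p a k * ∏ u, p u (δ u) := by
    rw [← mul_prod_erase univ _ (mem_univ a),
      ← mul_prod_erase univ (fun u => p u (δ u)) (mem_univ a), Function.update_self,
      prod_congr rfl (g := fun u => p u (δ u)) fun u hu => by
        rw [Function.update_of_ne (ne_of_mem_erase hu)]]
    ring
  have swap_invol : Function.Involutive
      (fun z : β × (ι → β) => (z.2 a, Function.update z.2 a z.1)) := by
    rintro ⟨k, δ⟩
    simp
  calc ∑ δ : ι → β, (∏ u, p u (δ u)) * F (δ a) δ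
      = ∑ z : β × (ι → β), p a z.1 * ((∏ u, p u (z.2 u)) * F (z.2 a) z.2) := by
        simp only [Fintype.sum_prod_type]
        rw [← sum_mul_sum, hp, one_mul]
    _ = ∑ z : β × (ι → β), p a z.1 * ((∏ u, p u (z.2 u)) * F z.1 z.2) := by
        refine Fintype.sum_equiv swap_invol.toPerm _ _ ?_
        rintro ⟨k, δ⟩
        simp only [Function.Involutive.coe_toPerm, hF]
        rw [← mul_assoc, ← mul_assoc, weight_swap]
    _ = _ := by
        rw [Fintype.sum_prod_type]
        simp only [mul_sum]

theorem sum_add_sq_div_eq_one_add {ι : Type*} (s : Finset ι) (e p : ι → ℝ)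
    (hp : ∀ j ∈ s, p j ≠ 0) (hp_sum : ∑ j ∈ s, p j = 1) (he : ∑ j ∈ s, (e j + p j) = 1) :
    ∑ j ∈ s, (e j + p j) ^ 2 / p j = 1 + ∑ j ∈ s, e j ^ 2 / p j := by
  have expand : ∀ j ∈ s, (e j + p j) ^ 2 / p j = e j ^ 2 / p j + 2 * (e j + p j) - p j := by
    intro j hj
    have := hp j hj
    field_simp
    ring
  rw [sum_congr rfl expand, sum_sub_distrib, sum_add_distrib, ← mul_sum, he, hp_sum]
  ring

theorem forwardAlpha_pos {N : ℕ} {α1 : Fin N → ℝ} (hα1 : ∀ i, 0 < α1 i)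
    {Φ : ℕ → Fin N → Fin N → ℝ} (hΦ : ∀ t i j, 0 < Φ t i j) (t : ℕ) (i : Fin N) :
    0 < forwardAlpha α1 Φ t i := by
  induction t generalizing i with
  | zero => exact hα1 i
  | succ t ih => exact sum_pos (fun j _ => mul_pos (ih j) (hΦ t j i)) ⟨i, mem_univ i⟩

/-- multiplicative growth of relative second moments in single-sample
Randomized Forward. With `J_t = max_j E[α̂_t(j)²]/α_t(j)²` and
`C_t = max_i (1 + Σ_j ε_t(j,i)²/q_t(j))`, where
`ε_t(j,i) = α_t(j)Φ_t(j,i)/α_{t+1}(i) − q_t(j)`, one has (0-based) `J_1 = 1`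
(`J 0 = 1`), `J_{t+1} ≤ C_t·J_t` for every step `t`, and consequently
`J_T ≤ Π_{t=1}^{T−1} C_t` (`J (T-1) ≤ ∏_{t ∈ range (T-1)} C t`). -/
theorem ss_forward_relative_second_moment_growth
    (N T : ℕ) (hN : 0 < N) (hT : 1 ≤ T)
    (α1 : Fin N → ℝ) (hα1 : ∀ i, 0 < α1 i)
    (Φ : ℕ → Fin N → Fin N → ℝ) (hΦ : ∀ t i j, 0 < Φ t i j)
    (q : ℕ → Fin N → ℝ) (hq_pos : ∀ t j, 0 < q t j)
    (hq_sum : ∀ t, ∑ j, q t j = 1) :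
    let E2 : ℕ → Fin N → ℝ := fun s j =>
      ∑ δ : Fin T → Fin N,
        (∏ u : Fin T, q u.1 (δ u)) *
          (ssForwardAlpha α1 Φ q
            (fun u => if h : u < T then δ ⟨u, h⟩ else ⟨0, hN⟩) s j) ^ 2
    let ε : ℕ → Fin N → Fin N → ℝ := fun t j i =>
      forwardAlpha α1 Φ t j * Φ t j i / forwardAlpha α1 Φ (t + 1) i - q t j
    let J : ℕ → ℝ := fun t =>
      Finset.univ.sup' ⟨⟨0, hN⟩, Finset.mem_univ _⟩
        (fun j => E2 t j / (forwardAlpha α1 Φ t j) ^ 2)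
    let C : ℕ → ℝ := fun t =>
      Finset.univ.sup' ⟨⟨0, hN⟩, Finset.mem_univ _⟩
        (fun i => 1 + ∑ j, (ε t j i) ^ 2 / q t j)
    J 0 = 1 ∧
      (∀ t, t + 1 < T → J (t + 1) ≤ C t * J t) ∧
      J (T - 1) ≤ ∏ t ∈ Finset.range (T - 1), C t := by
  intro E2 ε J C
  have α_pos := forwardAlpha_pos hα1 hΦ
  have weight_sum : ∑ δ : Fin T → Fin N, ∏ u : Fin T, q u.1 (δ u) = 1 := by
    rw [← Fintype.prod_sum]
    exact prod_eq_one fun u _ => hq_sum u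
  have E2_nonneg (t : ℕ) (j : Fin N) : 0 ≤ E2 t j :=
    sum_nonneg fun δ _ => mul_nonneg (prod_nonneg fun u _ => (hq_pos _ _).le) (sq_nonneg _)
  have E2_succ (t : ℕ) (ht : t < T) (i : Fin N) :
      E2 (t + 1) i = ∑ k, E2 t k * (Φ t k i ^ 2 / q t k) := by
    have split := sum_prod_mul_eval_eq_sum_mul_sum (fun u : Fin T => q u.1) ⟨t, ht⟩ (hq_sum t)
      (fun k δ => (ssForwardAlpha α1 Φ q
        (fun u => if h : u < T then δ ⟨u, h⟩ else ⟨0, hN⟩) t k * Φ t k i / q t k) ^ 2)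
      (by
        intro k δ x
        rw [ssForwardAlpha_congr α1 Φ q
          (δ' := fun u => if h : u < T then δ ⟨u, h⟩ else ⟨0, hN⟩)]
        intro s hs
        simp [hs.trans ht, Function.update_of_ne, hs.ne])
    simp only [E2, ssForwardAlpha, dif_pos ht]
    refine split.trans (sum_congr rfl fun k _ => ?_)
    have := (hq_pos t k).ne'
    rw [mul_sum, sum_mul]
    refine sum_congr rfl fun δ _ => ?_
    field_simp
  have E2_le (t : ℕ) (j : Fin N) : E2 t j ≤ J t * forwardAlpha α1 Φ t j ^ 2 := by
    rw [← div_le_iff₀ (pow_pos (α_pos t j) 2)]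
    exact le_sup' (fun j => E2 t j / forwardAlpha α1 Φ t j ^ 2) (mem_univ j)
  have J_nonneg (t : ℕ) : 0 ≤ J t :=
    (div_nonneg (E2_nonneg t ⟨0, hN⟩) (sq_nonneg _)).trans
      (le_sup' (fun j => E2 t j / forwardAlpha α1 Φ t j ^ 2) (mem_univ _))
  have le_C (t : ℕ) (i : Fin N) : 1 + ∑ j, ε t j i ^ 2 / q t j ≤ C t :=
    le_sup' (fun i => 1 + ∑ j, ε t j i ^ 2 / q t j) (mem_univ i)
  have C_nonneg (t : ℕ) : 0 ≤ C t :=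
    (add_nonneg zero_le_one
      (sum_nonneg fun j _ => div_nonneg (sq_nonneg _) (hq_pos t j).le)).trans (le_C t ⟨0, hN⟩)
  have gap_sum (t : ℕ) (i : Fin N) :
      ∑ k, (forwardAlpha α1 Φ t k * Φ t k i / forwardAlpha α1 Φ (t + 1) i) ^ 2 / q t k =
        1 + ∑ j, ε t j i ^ 2 / q t j := by
    rw [← sum_add_sq_div_eq_one_add univ (fun j => ε t j i) (q t) (fun j _ => (hq_pos t j).ne')
      (hq_sum t)]
    · simp only [ε, sub_add_cancel]
    · simp only [ε, sub_add_cancel]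
      rw [← sum_div]
      exact div_self (α_pos (t + 1) i).ne'
  have J_zero : J 0 = 1 := by
    have ratio (j : Fin N) : E2 0 j / forwardAlpha α1 Φ 0 j ^ 2 = 1 := by
      simp only [E2, ssForwardAlpha, forwardAlpha]
      rw [← sum_mul, weight_sum, one_mul]
      exact div_self (pow_pos (hα1 j) 2).ne'
    simp only [J, ratio]
    exact sup'_const _ _
  have J_succ (t : ℕ) (ht : t + 1 < T) : J (t + 1) ≤ C t * J t := by
    refine sup'_le _ _ fun i _ => ?_
    have α_ne := (α_pos (t + 1) i).ne'
    calc E2 (t + 1) i / forwardAlpha α1 Φ (t + 1) i ^ 2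
        ≤ (∑ k, J t * forwardAlpha α1 Φ t k ^ 2 * (Φ t k i ^ 2 / q t k)) /
            forwardAlpha α1 Φ (t + 1) i ^ 2 := by
          rw [E2_succ t (t.lt_succ_self.trans ht)]
          gcongr with k
          · exact div_nonneg (sq_nonneg _) (hq_pos t k).le
          · exact E2_le t k
      _ = (1 + ∑ j, ε t j i ^ 2 / q t j) * J t := by
          rw [← gap_sum, sum_div, sum_mul]
          refine sum_congr rfl fun k _ => ?_
          have := (hq_pos t k).ne'
          field_simp
      _ ≤ C t * J t := mul_le_mul_of_nonneg_right (le_C t i) (J_nonneg t)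
  have J_le_prod (n : ℕ) (hn : n < T) : J n ≤ ∏ t ∈ range n, C t := by
    induction n with
    | zero => simp [J_zero]
    | succ n ih =>
      rw [prod_range_succ, mul_comm]
      exact (J_succ n hn).trans
        (mul_le_mul_of_nonneg_left (ih (n.lt_succ_self.trans hn)) (C_nonneg n))
  exact ⟨J_zero, J_succ, J_le_prod (T - 1) (by omega)⟩
end
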